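/- arXiv:math/0304350 — 5 statements merged into one kernel-verified Lean document; each statement's English description precedes it below -/
import Mathlib

section
/- Let {L_α}_{α∈Ω} be a family of simple closure spaces, L_α on Σ_α, and let 𝚺 = ∏_α Σ_α. Then ∧○_α L_α and ∨○_α L_α are weak tensor products, i.e. they belong to S(L_α, α∈Ω); moreover ∧○_α L_α is the bottom element and ∨○_α L_α the top element of S(L_α, α∈Ω), so that S(L_α, α∈Ω) = {L : L a simple closure space on 𝚺 with ∧○_α L_α ⊆ L ⊆ ∨○_α L_α}; and S(L_α, α∈Ω), ordered by set-inclusion, is a complete lattice (in particular it is closed under arbitrary intersections). -/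
open Set

namespace QLTensor

universe u v w

/-- A simple closure space on `X`: a set of subsets of `X`, closed under arbitrary
set-intersections, containing `∅`, `univ` and all singletons. -/
def IsSCS {X : Type*} (L : Set (Set X)) : Prop :=
  (∀ ω ⊆ L, ⋂₀ ω ∈ L) ∧ ∅ ∈ L ∧ Set.univ ∈ L ∧ ∀ p : X, ({p} : Set X) ∈ L

/-- The join in a simple closure space: `⋁ A = ⋂ {b ∈ L | A ⊆ b}`. -/
def cl {X : Type*} (L : Set (Set X)) (A : Set X) : Set X :=
  ⋂₀ {b | b ∈ L ∧ A ⊆ b}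

/-- `b` covers `a` in the lattice `L` (both belonging to `L`). -/
def CoversIn {X : Type*} (L : Set (Set X)) (a b : Set X) : Prop :=
  a ∈ L ∧ b ∈ L ∧ a ⊂ b ∧ ∀ c ∈ L, a ⊂ c → c ⊂ b → False

/-- `x` is a coatom of `L` (covered by the top element `univ`). -/
def IsCoatomIn {X : Type*} (L : Set (Set X)) (x : Set X) : Prop :=
  x ∈ L ∧ x ≠ Set.univ ∧ ∀ c ∈ L, x ⊂ c → c = Set.univ

/-- `L` is coatomistic: every element is an intersection of coatoms. -/
def Coatomistic {X : Type*} (L : Set (Set X)) : Prop :=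
  ∀ a ∈ L, a = ⋂₀ {x | IsCoatomIn L x ∧ a ⊆ x}

/-- The covering property: if `p ∧ a = 0` then `p ∨ a` covers `a`. -/
def CovProp {X : Type*} (L : Set (Set X)) : Prop :=
  ∀ p : X, ∀ a ∈ L, p ∉ a → CoversIn L a (cl L (insert p a))

/-- The covering property of the dual lattice. -/
def DualCovProp {X : Type*} (L : Set (Set X)) : Prop :=
  ∀ x : Set X, IsCoatomIn L x → ∀ a ∈ L, cl L (a ∪ x) = Set.univ →
    CoversIn L (a ∩ x) a

/-- A DAC-lattice: `L` and its dual are atomistic with the covering property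
(a simple closure space is automatically atomistic). -/
def IsDAC {X : Type*} (L : Set (Set X)) : Prop :=
  CovProp L ∧ Coatomistic L ∧ DualCovProp L

/-- `(a, b)` is a modular pair: `(c ∨ a) ∧ b = c ∨ (a ∧ b)` for all `c ≤ b`. -/
def ModularPairIn {X : Type*} (L : Set (Set X)) (a b : Set X) : Prop :=
  ∀ c ∈ L, c ⊆ b → cl L (c ∪ a) ∩ b = cl L (c ∪ a ∩ b)

/-- `z` is a central element of the simple closure space `L`. -/
def IsCentralIn {X : Type*} (L : Set (Set X)) (z : Set X) : Prop :=
  zᶜ ∈ L ∧ ModularPairIn L z zᶜ ∧ ModularPairIn L zᶜ z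

/-- `L` is irreducible: its only central elements are `∅` and `univ`. -/
def IrreducibleSCS {X : Type*} (L : Set (Set X)) : Prop :=
  ∀ z ∈ L, IsCentralIn L z → z = ∅ ∨ z = Set.univ

/-- `N` is an orthocomplementation of the simple closure space `L`. -/
def IsOrtho {X : Type*} (L : Set (Set X)) (N : Set X → Set X) : Prop :=
  (∀ a ∈ L, N a ∈ L) ∧ (∀ a ∈ L, N (N a) = a) ∧
  (∀ a ∈ L, ∀ b ∈ L, a ⊆ b → N b ⊆ N a) ∧
  ∀ a ∈ L, cl L (a ∪ N a) = Set.univ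

/-- `L` with orthocomplementation `N` is orthomodular. -/
def OrthomodularIn {X : Type*} (L : Set (Set X)) (N : Set X → Set X) : Prop :=
  ∀ a ∈ L, ∀ b ∈ L, a ⊆ b → b = cl L (a ∪ b ∩ N a)

/-- `L` contains `MO₃`. -/
def ContainsMO3 {X : Type*} (L : Set (Set X)) : Prop :=
  ∃ p q r : X, p ≠ q ∧ p ≠ r ∧ q ≠ r ∧
    CoversIn L {p} (cl L {p, q}) ∧ CoversIn L {q} (cl L {p, q}) ∧
    CoversIn L {r} (cl L {p, q})

/-- `L` contains `MO₄`. -/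
def ContainsMO4 {X : Type*} (L : Set (Set X)) : Prop :=
  ∃ p₁ p₂ p₃ p₄ : X,
    p₁ ≠ p₂ ∧ p₁ ≠ p₃ ∧ p₁ ≠ p₄ ∧ p₂ ≠ p₃ ∧ p₂ ≠ p₄ ∧ p₃ ≠ p₄ ∧
    CoversIn L {p₁} (cl L {p₁, p₄}) ∧ CoversIn L {p₂} (cl L {p₁, p₄}) ∧
    CoversIn L {p₃} (cl L {p₁, p₄}) ∧ CoversIn L {p₄} (cl L {p₁, p₄})

/-- `L` is connected. -/
def ConnectedSCS {X : Type*} (L : Set (Set X)) : Prop :=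
  (∃ p q : X, p ≠ q) ∧
  ∀ p q : X, p ≠ q → ∃ r : X, r ≠ p ∧ r ≠ q ∧ r ∈ cl L {p, q} ∧
    p ∈ cl L {q, r} ∧ q ∈ cl L {p, r}

/-- `L` is weakly connected: `L ≠ 2` and the point set admits a connected covering. -/
def WeaklyConnected {X : Type*} (L : Set (Set X)) : Prop :=
  (∃ p q : X, p ≠ q) ∧
  ∃ 𝒜 : Set (Set X),
    ⋃₀ 𝒜 = Set.univ ∧
    (∀ A ∈ 𝒜, ∃ p ∈ A, ∃ q ∈ A, p ≠ q) ∧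
    (∀ A ∈ 𝒜, ∀ p ∈ A, ∀ q ∈ A, p ≠ q → ∃ r, r ≠ p ∧ r ≠ q ∧ r ∈ cl L {p, q}) ∧
    ∀ p q : X, ∃ (m : ℕ) (c : Fin (m + 1) → Set X),
      (∀ i, c i ∈ 𝒜) ∧ p ∈ c 0 ∧ q ∈ c (Fin.last m) ∧
      ∀ i : Fin m, ∃ x ∈ c i.castSucc ∩ c i.succ, ∃ y ∈ c i.castSucc ∩ c i.succ, x ≠ y

/-- The central cover `e(p)` of an atom `p`. -/
def centralCover {X : Type*} (L : Set (Set X)) (p : X) : Set X :=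
  ⋂₀ {z | z ∈ L ∧ IsCentralIn L z ∧ p ∈ z}

/-- The interval `[0, e]` of `L`, viewed as a simple closure space on `e`. -/
def restrictSCS {X : Type*} (L : Set (Set X)) (e : Set X) : Set (Set ↥e) :=
  {B | Subtype.val '' B ∈ L}

/-- The automorphism group of `M` acts transitively on points. -/
def TransitiveSCS {X : Type*} (M : Set (Set X)) : Prop :=
  ∀ p q : X, ∃ u : X ≃ X, (∀ a : Set X, a ∈ M ↔ u '' a ∈ M) ∧ u p = q

section Pi

variable {Ω : Type*} {σ : Ω → Type*}

/-- `⋃_α π_α⁻¹ (a α)`. -/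
def unionCyl (a : ∀ α, Set (σ α)) : Set (∀ α, σ α) :=
  {p | ∃ α, p α ∈ a α}

/-- `∏_α a_α`. -/
def prodSet (a : ∀ α, Set (σ α)) : Set (∀ α, σ α) :=
  {p | ∀ α, p α ∈ a α}

/-- `p[A, β]`. -/
def cylSet (p : ∀ α, σ α) (β : Ω) (A : Set (σ β)) : Set (∀ α, σ α) :=
  {q | q β ∈ A ∧ ∀ α, α ≠ β → q α = p α}

/-- `R_β[p]`. -/
def secSet (R : Set (∀ α, σ α)) (β : Ω) (p : ∀ α, σ α) : Set (σ β) :=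
  {x | ∃ q ∈ R, q β = x ∧ ∀ α, α ≠ β → q α = p α}

/-- The separated product `∧○_α L_α`. -/
def wedgeO (L : ∀ α, Set (Set (σ α))) : Set (Set (∀ α, σ α)) :=
  {S | ∃ ω : Set (Set (∀ α, σ α)),
    (∀ y ∈ ω, ∃ a : ∀ α, Set (σ α), (∀ α, a α ∈ L α) ∧ y = unionCyl a) ∧ S = ⋂₀ ω}

/-- The product `∨○_α L_α`. -/
def veeO (L : ∀ α, Set (Set (σ α))) : Set (Set (∀ α, σ α)) :=
  {R | ∀ (β : Ω) (p : ∀ α, σ α), secSet R β p ∈ L β}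

/-- Axiom P2. -/
def AxiomP2 (L : ∀ α, Set (Set (σ α))) (M : Set (Set (∀ α, σ α))) : Prop :=
  ∀ a : ∀ α, Set (σ α), (∀ α, a α ∈ L α) → unionCyl a ∈ M

/-- Axiom P3. -/
def AxiomP3 (L : ∀ α, Set (Set (σ α))) (M : Set (Set (∀ α, σ α))) : Prop :=
  ∀ (p : ∀ α, σ α) (β : Ω) (A : Set (σ β)), cylSet p β A ∈ M → A ∈ L β

/-- `M` is a weak tensor product of the family `L`, i.e. `M ∈ S(L_α, α ∈ Ω)`. -/
def IsWTP (L : ∀ α, Set (Set (σ α))) (M : Set (Set (∀ α, σ α))) : Prop :=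
  IsSCS M ∧ AxiomP2 L M ∧ AxiomP3 L M

/-- `p # q` iff `p_β ⊥_β q_β` for some `β`. -/
def hashRel (N : ∀ α, Set (σ α) → Set (σ α)) (p q : ∀ α, σ α) : Prop :=
  ∃ β, p β ∈ N β {q β}

/-- `R^#`. -/
def sharp (N : ∀ α, Set (σ α) → Set (σ α)) (R : Set (∀ α, σ α)) :
    Set (∀ α, σ α) :=
  {q | ∀ p ∈ R, hashRel N q p}

/-- A join-preserving map `u` is large. -/
def LargeMap (u : Set (∀ α, σ α) → Set (∀ α, σ α)) : Prop :=
  ∀ (β : Ω) (p : ∀ α, σ α),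
    (¬ ∃ x, u (cylSet p β Set.univ) = {x}) ∧ ¬ u Set.univ ⊆ {q | q β = p β}

end Pi

section Binary

variable {X Y : Type*}

/-- The binary product `L₁ ∨○ L₂`. -/
def veeO2 (L1 : Set (Set X)) (L2 : Set (Set Y)) : Set (Set (X × Y)) :=
  {R | (∀ y : Y, {x | (x, y) ∈ R} ∈ L1) ∧ ∀ x : X, {y | (x, y) ∈ R} ∈ L2}

/-- The binary separated product `L₁ ∧○ L₂`. -/
def wedgeO2 (L1 : Set (Set X)) (L2 : Set (Set Y)) : Set (Set (X × Y)) :=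
  {S | ∃ ω : Set (Set (X × Y)),
    (∀ y ∈ ω, ∃ a₁ ∈ L1, ∃ a₂ ∈ L2,
      y = a₁ ×ˢ (Set.univ : Set Y) ∪ (Set.univ : Set X) ×ˢ a₂) ∧
    S = ⋂₀ ω}

end Binary

section Products

variable {Ω : Type*} {σ : Ω → Type*}

theorem mem_secSet_iff [DecidableEq Ω] {R : Set (∀ α, σ α)} {β : Ω} {p : ∀ α, σ α} {x : σ β} :
    x ∈ secSet R β p ↔ Function.update p β x ∈ R := by
  constructor
  · rintro ⟨q, hq, rfl, h⟩
    have : Function.update p β (q β) = q := by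
      rw [Function.update_eq_iff]
      exact ⟨rfl, fun α hα => (h α hα).symm⟩
    rwa [this]
  · intro h
    exact ⟨_, h, by simp, fun α hα => by simp [hα]⟩

theorem secSet_sInter (ω : Set (Set (∀ α, σ α))) (β : Ω) (p : ∀ α, σ α) :
    secSet (⋂₀ ω) β p = ⋂₀ ((fun R => secSet R β p) '' ω) := by
  classical
  ext x
  simp [mem_secSet_iff]

theorem secSet_cylSet (p : ∀ α, σ α) (β : Ω) (A : Set (σ β)) :
    secSet (cylSet p β A) β p = A := by
  classical
  ext x
  rw [mem_secSet_iff]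
  simp +contextual [cylSet]

theorem cylSet_secSet (R : Set (∀ α, σ α)) (p : ∀ α, σ α) (β : Ω) :
    cylSet p β (secSet R β p) = R ∩ cylSet p β univ := by
  ext q
  constructor
  · rintro ⟨⟨r, hr, hrq, hrp⟩, hqp⟩
    have : r = q := by
      funext α
      by_cases h : α = β
      · subst h; exact hrq
      · rw [hrp α h, hqp α h]
    subst this
    exact ⟨hr, mem_univ _, hqp⟩
  · rintro ⟨hq, -, hqp⟩
    exact ⟨⟨q, hq, rfl, hqp⟩, hqp⟩

theorem mem_unionCyl_update_empty [DecidableEq Ω] {β : Ω} {A : Set (σ β)} {q : ∀ α, σ α} :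
    q ∈ unionCyl (Function.update (fun α => (∅ : Set (σ α))) β A) ↔ q β ∈ A := by
  constructor
  · rintro ⟨α, hα⟩
    by_cases h : α = β
    · subst h; simpa using hα
    · simp [h] at hα
  · intro h
    exact ⟨β, by simpa using h⟩

variable {L : ∀ α, Set (Set (σ α))}

theorem IsSCS.inter_mem {X : Type*} {M : Set (Set X)} (hM : IsSCS M) {a b : Set X}
    (ha : a ∈ M) (hb : b ∈ M) : a ∩ b ∈ M := by
  rw [← sInter_pair]
  exact hM.1 _ (by simp [insert_subset_iff, ha, hb])

theorem unionCyl_mem_wedgeO {a : ∀ α, Set (σ α)} (ha : ∀ α, a α ∈ L α) :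
    unionCyl a ∈ wedgeO L :=
  ⟨{unionCyl a}, by rintro y rfl; exact ⟨a, ha, rfl⟩, by simp⟩

theorem sInter_mem_wedgeO {ω : Set (Set (∀ α, σ α))} (hω : ω ⊆ wedgeO L) :
    ⋂₀ ω ∈ wedgeO L := by
  refine ⟨{y | (∃ a : ∀ α, Set (σ α), (∀ α, a α ∈ L α) ∧ y = unionCyl a) ∧ ⋂₀ ω ⊆ y},
    fun y hy => hy.1, Subset.antisymm (fun q hq y hy => hy.2 hq) ?_⟩
  intro q hq S hS
  obtain ⟨ω', hω', rfl⟩ := hω hS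
  exact fun y hy => hq y ⟨hω' y hy, (sInter_subset_of_mem hS).trans (sInter_subset_of_mem hy)⟩

theorem cylinder_mem_wedgeO [DecidableEq Ω] (hL : ∀ α, IsSCS (L α)) {β : Ω} {A : Set (σ β)}
    (hA : A ∈ L β) : {q : ∀ α, σ α | q β ∈ A} ∈ wedgeO L := by
  have h : {q : ∀ α, σ α | q β ∈ A} =
      unionCyl (Function.update (fun α => (∅ : Set (σ α))) β A) := by
    ext q
    exact mem_unionCyl_update_empty.symm
  rw [h]
  refine unionCyl_mem_wedgeO fun α => ?_
  by_cases h : α = β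
  · subst h; simpa using hA
  · simpa [h] using (hL α).2.1

theorem setOf_forall_eq_mem_wedgeO (hL : ∀ α, IsSCS (L α)) (p : ∀ α, σ α) (P : Ω → Prop) :
    {q : ∀ α, σ α | ∀ α, P α → q α = p α} ∈ wedgeO L := by
  classical
  have h : {q : ∀ α, σ α | ∀ α, P α → q α = p α} =
      ⋂₀ {y | ∃ α, P α ∧ y = {q : ∀ α, σ α | q α ∈ ({p α} : Set (σ α))}} := by
    ext q
    simp only [mem_ofPred_eq, mem_sInter]
    constructor
    · rintro hq _ ⟨α, hα, rfl⟩
      exact hq α hα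
    · exact fun hq α hα => hq _ ⟨α, hα, rfl⟩
  rw [h]
  refine sInter_mem_wedgeO ?_
  rintro _ ⟨α, -, rfl⟩
  exact cylinder_mem_wedgeO hL ((hL α).2.2.2 _)

theorem cylSet_univ_mem_wedgeO (hL : ∀ α, IsSCS (L α)) (p : ∀ α, σ α) (β : Ω) :
    cylSet p β univ ∈ wedgeO L := by
  simpa [cylSet] using setOf_forall_eq_mem_wedgeO hL p (· ≠ β)

theorem isSCS_wedgeO (hL : ∀ α, IsSCS (L α)) :
    IsSCS (wedgeO L) := by
  refine ⟨fun ω hω => sInter_mem_wedgeO hω, ?_, ⟨∅, by simp, by simp⟩, fun p => ?_⟩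
  · have h := unionCyl_mem_wedgeO fun α => (hL α).2.1
    have h0 : unionCyl (fun α => (∅ : Set (σ α))) = ∅ := by
      ext q
      simp [unionCyl]
    rwa [h0] at h
  · have h : ({p} : Set (∀ α, σ α)) = {q | ∀ α, True → q α = p α} := by
      ext q
      simp [funext_iff]
    rw [h]
    exact setOf_forall_eq_mem_wedgeO hL p _

theorem isSCS_veeO (hL : ∀ α, IsSCS (L α)) : IsSCS (veeO L) := by
  classical
  refine ⟨fun ω hω β p => ?_, fun β p => ?_, fun β p => ?_, fun q β p => ?_⟩
  · rw [secSet_sInter]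
    refine (hL β).1 _ ?_
    rintro _ ⟨R, hR, rfl⟩
    exact hω hR β p
  · have h : secSet (∅ : Set (∀ α, σ α)) β p = ∅ := by
      ext x
      simp [mem_secSet_iff]
    rw [h]
    exact (hL β).2.1
  · have h : secSet (univ : Set (∀ α, σ α)) β p = univ := by
      ext x
      simp [mem_secSet_iff]
    rw [h]
    exact (hL β).2.2.1
  · by_cases hq : ∀ α, α ≠ β → q α = p α
    · have h : secSet {q} β p = {q β} := by
        ext x
        constructor
        · rintro ⟨r, rfl, rfl, -⟩
          rfl
        · rintro rfl
          exact ⟨q, rfl, rfl, hq⟩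
      rw [h]
      exact (hL β).2.2.2 _
    · have h : secSet {q} β p = ∅ := by
        rw [eq_empty_iff_forall_notMem]
        rintro x ⟨r, rfl, -, hr⟩
        exact hq hr
      rw [h]
      exact (hL β).2.1

theorem unionCyl_mem_veeO (hL : ∀ α, IsSCS (L α)) {a : ∀ α, Set (σ α)} (ha : ∀ α, a α ∈ L α) :
    unionCyl a ∈ veeO L := by
  classical
  intro β p
  by_cases hp : ∃ α, α ≠ β ∧ p α ∈ a α
  · obtain ⟨α, hα, hpα⟩ := hp
    have h : secSet (unionCyl a) β p = univ := by
      refine eq_univ_of_forall fun x => mem_secSet_iff.2 ⟨α, ?_⟩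
      simpa [hα] using hpα
    rw [h]
    exact (hL β).2.2.1
  · have h : secSet (unionCyl a) β p = a β := by
      ext x
      rw [mem_secSet_iff]
      constructor
      · rintro ⟨α, hα⟩
        by_cases hαβ : α = β
        · subst hαβ; simpa using hα
        · exact absurd ⟨α, hαβ, by simpa [hαβ] using hα⟩ hp
      · exact fun hx => ⟨β, by simpa using hx⟩
    rw [h]
    exact ha β

theorem wedgeO_subset {M : Set (Set (∀ α, σ α))} (hM : IsSCS M) (h2 : AxiomP2 L M) :
    wedgeO L ⊆ M := by
  rintro _ ⟨ω, hω, rfl⟩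
  refine hM.1 _ fun y hy => ?_
  obtain ⟨a, ha, rfl⟩ := hω y hy
  exact h2 a ha

theorem isWTP_iff (hL : ∀ α, IsSCS (L α)) (M : Set (Set (∀ α, σ α))) :
    IsWTP L M ↔ IsSCS M ∧ wedgeO L ⊆ M ∧ M ⊆ veeO L := by
  constructor
  · rintro ⟨hM, h2, h3⟩
    have hw := wedgeO_subset hM h2
    refine ⟨hM, hw, fun R hR β p => h3 p β _ ?_⟩
    rw [cylSet_secSet]
    exact hM.inter_mem hR (hw (cylSet_univ_mem_wedgeO hL p β))
  · rintro ⟨hM, hw, hv⟩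
    refine ⟨hM, fun a ha => hw (unionCyl_mem_wedgeO ha), fun p β A hA => ?_⟩
    rw [← secSet_cylSet p β A]
    exact hv hA β p

theorem isSCS_sInter {X : Type*} {ω : Set (Set (Set X))} (hω : ∀ M ∈ ω, IsSCS M) :
    IsSCS (⋂₀ ω) :=
  ⟨fun _ hS M hM => (hω M hM).1 _ fun _ hs => hS hs M hM, fun M hM => (hω M hM).2.1,
    fun M hM => (hω M hM).2.2.1, fun p M hM => (hω M hM).2.2.2 p⟩

end Products

/-- `∧○_α L_α` and `∨○_α L_α` are weak tensor products; they are the bottom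
and top elements of `S(L_α, α ∈ Ω)`, so that `S` is exactly the set of simple closure
spaces squeezed between them; and `S`, ordered by set-inclusion, is a complete lattice
(in particular closed under nonempty arbitrary intersections). -/
theorem stmt0 {Ω : Type*} {σ : Ω → Type*} [∀ α, Nonempty (σ α)]
    (L : ∀ α, Set (Set (σ α))) (hL : ∀ α, IsSCS (L α)) :
    IsWTP L (wedgeO L) ∧ IsWTP L (veeO L) ∧
    (∀ M : Set (Set (∀ α, σ α)),
      IsWTP L M ↔ IsSCS M ∧ wedgeO L ⊆ M ∧ M ⊆ veeO L) ∧
    ∀ ω : Set (Set (Set (∀ α, σ α))), ω.Nonempty → (∀ M ∈ ω, IsWTP L M) →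
      IsWTP L (⋂₀ ω) := by
  have hwv : wedgeO L ⊆ veeO L :=
    wedgeO_subset (isSCS_veeO hL) fun _ ha => unionCyl_mem_veeO hL ha
  refine ⟨(isWTP_iff hL _).2 ⟨isSCS_wedgeO hL, Subset.rfl, hwv⟩,
    (isWTP_iff hL _).2 ⟨isSCS_veeO hL, hwv, Subset.rfl⟩, isWTP_iff hL, fun ω ⟨M₀, hM₀⟩ hω => ?_⟩
  exact (isWTP_iff hL _).2 ⟨isSCS_sInter fun M hM => (hω M hM).1,
    subset_sInter fun M hM => ((isWTP_iff hL M).1 (hω M hM)).2.1,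
    (sInter_subset_of_mem hM₀).trans ((isWTP_iff hL M₀).1 (hω M₀ hM₀)).2.2⟩

end QLTensor
end

section
/- Let {L_α}_{α∈Ω} be a family of orthocomplemented simple closure spaces, L_α on Σ_α, and 𝚺 = ∏_α Σ_α. For p, q ∈ 𝚺 define p # q iff there exists β ∈ Ω with p_β ⊥_β q_β, and for R ⊆ 𝚺 let R^# = {q ∈ 𝚺 : q # p for all p ∈ R}. Then the Aerts separated product {R ⊆ 𝚺 : R^{##} = R} equals ∧○_α L_α (as sets of subsets of 𝚺), and the map R ↦ R^# is an orthocomplementation of ∧○_α L_α. -/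
open Set

namespace QLTensor

universe u v w

section Ortho

variable {X : Type*} {L : Set (Set X)} {N : Set X → Set X}

lemma IsOrtho.symm_singleton (hN : IsOrtho L N) (hL : IsSCS L) {x y : X} (h : x ∈ N {y}) :
    y ∈ N {x} := by
  have h1 := hN.2.2.1 {x} (hL.2.2.2 x) (N {y}) (hN.1 _ (hL.2.2.2 y)) (singleton_subset_iff.2 h)
  rw [hN.2.1 _ (hL.2.2.2 y)] at h1
  exact singleton_subset_iff.1 h1

lemma IsOrtho.map_univ (hN : IsOrtho L N) (hL : IsSCS L) : N univ = ∅ := by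
  have h1 := hN.2.2.1 (N ∅) (hN.1 _ hL.2.1) univ hL.2.2.1 (subset_univ _)
  rw [hN.2.1 _ hL.2.1] at h1
  exact subset_empty_iff.1 h1

lemma IsOrtho.notMem_singleton (hN : IsOrtho L N) (hL : IsSCS L) (x : X) : x ∉ N {x} := by
  intro hx
  have hs := hL.2.2.2 x
  have htop : N {x} = univ := by
    refine univ_subset_iff.1 ?_
    rw [← hN.2.2.2 {x} hs]
    exact sInter_subset_of_mem ⟨hN.1 _ hs, union_subset (singleton_subset_iff.2 hx) subset_rfl⟩
  have h1 := hN.2.1 {x} hs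
  rw [htop, hN.map_univ hL] at h1
  exact (singleton_ne_empty x) h1.symm

lemma IsOrtho.exists_notMem_singleton (hN : IsOrtho L N) (hL : IsSCS L) {a : Set X} (ha : a ∈ L)
    {x : X} (hx : x ∉ a) : ∃ y ∈ N a, x ∉ N {y} := by
  by_contra! h
  have hsub : N a ⊆ N {x} := fun y hy => hN.symm_singleton hL (h y hy)
  have h1 := hN.2.2.1 _ (hN.1 a ha) _ (hN.1 _ (hL.2.2.2 x)) hsub
  rw [hN.2.1 a ha, hN.2.1 _ (hL.2.2.2 x)] at h1
  exact hx (singleton_subset_iff.1 h1)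

end Ortho

section Sharp

variable {Ω : Type*} {σ : Ω → Type*} {L : ∀ α, Set (Set (σ α))}
  {N : ∀ α, Set (σ α) → Set (σ α)}

lemma hashRel_symm (hL : ∀ α, IsSCS (L α)) (hN : ∀ α, IsOrtho (L α) (N α)) {p q : ∀ α, σ α}
    (h : hashRel N p q) : hashRel N q p :=
  h.imp fun β hβ => (hN β).symm_singleton (hL β) hβ

lemma sharp_anti (N : ∀ α, Set (σ α) → Set (σ α)) {R S : Set (∀ α, σ α)} (h : R ⊆ S) :
    sharp N S ⊆ sharp N R :=
  fun _ hq p hp => hq p (h hp)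

lemma subset_sharp_sharp (hL : ∀ α, IsSCS (L α)) (hN : ∀ α, IsOrtho (L α) (N α))
    (R : Set (∀ α, σ α)) : R ⊆ sharp N (sharp N R) :=
  fun p hp _ hq => hashRel_symm hL hN (hq p hp)

lemma sharp_mem_wedgeO (hL : ∀ α, IsSCS (L α)) (hN : ∀ α, IsOrtho (L α) (N α))
    (R : Set (∀ α, σ α)) : sharp N R ∈ wedgeO L := by
  refine ⟨(fun p => unionCyl fun α => N α {p α}) '' R, ?_, ?_⟩
  · rintro _ ⟨p, -, rfl⟩
    exact ⟨_, fun α => (hN α).1 _ ((hL α).2.2.2 _), rfl⟩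
  · rw [sInter_image]
    ext q
    simp only [mem_iInter]
    rfl

lemma sharp_sharp_unionCyl_subset (hL : ∀ α, IsSCS (L α)) (hN : ∀ α, IsOrtho (L α) (N α))
    {a : ∀ α, Set (σ α)} (ha : ∀ α, a α ∈ L α) :
    sharp N (sharp N (unionCyl a)) ⊆ unionCyl a := by
  intro p hp
  by_contra hpa
  have hpa' : ∀ α, p α ∉ a α := fun α h => hpa ⟨α, h⟩
  choose q hqa hpq using fun α => (hN α).exists_notMem_singleton (hL α) (ha α) (hpa' α)
  have hq : q ∈ sharp N (unionCyl a) := by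
    rintro r ⟨β, hβ⟩
    exact ⟨β, (hN β).2.2.1 _ ((hL β).2.2.2 _) _ (ha β) (singleton_subset_iff.2 hβ) (hqa β)⟩
  obtain ⟨β, hβ⟩ := hp q hq
  exact hpq β hβ

lemma setOf_sharp_sharp_eq_wedgeO (hL : ∀ α, IsSCS (L α)) (hN : ∀ α, IsOrtho (L α) (N α)) :
    {R : Set (∀ α, σ α) | sharp N (sharp N R) = R} = wedgeO L := by
  ext R
  constructor
  · intro hR
    rw [← show sharp N (sharp N R) = R from hR]
    exact sharp_mem_wedgeO hL hN _
  · rintro ⟨ω, hω, rfl⟩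
    refine (subset_sInter fun y hy => ?_).antisymm (subset_sharp_sharp hL hN _)
    obtain ⟨a, ha, rfl⟩ := hω y hy
    exact (sharp_anti N (sharp_anti N (sInter_subset_of_mem hy))).trans
      (sharp_sharp_unionCyl_subset hL hN ha)

end Sharp

/-- for orthocomplemented simple closure spaces, the Aerts separated product
`{R | R^## = R}` equals `∧○_α L_α`, and `R ↦ R^#` is an orthocomplementation of it. -/
theorem stmt1 {Ω : Type*} {σ : Ω → Type*} [∀ α, Nonempty (σ α)]
    (L : ∀ α, Set (Set (σ α))) (hL : ∀ α, IsSCS (L α))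
    (N : ∀ α, Set (σ α) → Set (σ α)) (hN : ∀ α, IsOrtho (L α) (N α)) :
    {R : Set (∀ α, σ α) | sharp N (sharp N R) = R} = wedgeO L ∧
    IsOrtho (wedgeO L) (sharp N) := by
  have heq := setOf_sharp_sharp_eq_wedgeO hL hN
  have hclosed : ∀ a ∈ wedgeO L, sharp N (sharp N a) = a := fun a ha => by
    rw [← heq] at ha
    exact ha
  refine ⟨heq, fun a _ => sharp_mem_wedgeO hL hN a, hclosed,
    fun a _ b _ hab => sharp_anti N hab, fun a ha => ?_⟩
  refine eq_univ_of_forall fun x => mem_sInter.2 ?_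
  rintro b ⟨hb, hab⟩
  rw [← hclosed b hb]
  intro q hq
  have h1 : q ∈ sharp N a := sharp_anti N (subset_union_left.trans hab) hq
  have h2 : q ∈ sharp N (sharp N a) := sharp_anti N (subset_union_right.trans hab) hq
  obtain ⟨β, hβ⟩ := h2 q h1
  exact absurd hβ ((hN β).notMem_singleton (hL β) (q β))


end QLTensor
end

section
/- Let L_1 and L_2 be atomistic lattices with 0 and 1. Then L_1 ∧○_n L_2 is order-isomorphic to the box product L_1 □ L_2 of Grätzer and Wehrung. -/
open Set

namespace QLTensor

universe u v w

/-- An atomistic lattice (every element determined, as a lower bound, by the atoms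
below it). -/
def AtomisticLat (L : Type*) [Lattice L] [BoundedOrder L] : Prop :=
  ∀ a b : L, (∀ p : L, IsAtom p → p ≤ a → p ≤ b) → a ≤ b

/-- The box product `L₁ □ L₂` of Grätzer and Wehrung: finite intersections of the sets
`a □ b = {(x,y) | x ≤ a or y ≤ b}`, ordered by set-inclusion. -/
def boxProd (L1 L2 : Type*) [Lattice L1] [BoundedOrder L1]
    [Lattice L2] [BoundedOrder L2] : Set (Set (L1 × L2)) :=
  {S | ∃ t : Finset (L1 × L2), t.Nonempty ∧
    S = ⋂ ab ∈ t, {xy : L1 × L2 | xy.1 ≤ ab.1 ∨ xy.2 ≤ ab.2}}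

/-- `L₁ ∧○_n L₂`: finite intersections of the sets
`Σ[a₁] × Σ₂ ∪ Σ₁ × Σ[a₂]`, ordered by set-inclusion. -/
def wedgeOn (L1 L2 : Type*) [Lattice L1] [BoundedOrder L1]
    [Lattice L2] [BoundedOrder L2] :
    Set (Set ({p : L1 // IsAtom p} × {q : L2 // IsAtom q})) :=
  {S | ∃ t : Finset (L1 × L2), t.Nonempty ∧
    S = ⋂ ab ∈ t, {pq | (pq.1 : L1) ≤ ab.1 ∨ (pq.2 : L2) ≤ ab.2}}

/-- The set of pairs of atoms lying in `S`. -/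
def atomTrace {L1 L2 : Type*} [Lattice L1] [BoundedOrder L1] [Lattice L2] [BoundedOrder L2]
    (S : Set (L1 × L2)) : Set ({p : L1 // IsAtom p} × {q : L2 // IsAtom q}) :=
  Prod.map Subtype.val Subtype.val ⁻¹' S

theorem AtomisticLat.exists_atom_le_not_le {L : Type*} [Lattice L] [BoundedOrder L]
    (h : AtomisticLat L) {a b : L} (hab : ¬ a ≤ b) : ∃ p, IsAtom p ∧ p ≤ a ∧ ¬ p ≤ b := by
  by_contra! H
  exact hab (h a b H)

section

variable {L1 L2 : Type*} [Lattice L1] [BoundedOrder L1] [Lattice L2] [BoundedOrder L2]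

theorem atomTrace_iInter_box (t : Finset (L1 × L2)) :
    atomTrace (⋂ ab ∈ t, {xy : L1 × L2 | xy.1 ≤ ab.1 ∨ xy.2 ≤ ab.2}) =
      ⋂ ab ∈ t, {pq | (pq.1 : L1) ≤ ab.1 ∨ (pq.2 : L2) ≤ ab.2} := by
  simp only [atomTrace, preimage_iInter]
  rfl

theorem isLowerSet_of_mem_boxProd {S : Set (L1 × L2)} (hS : S ∈ boxProd L1 L2) :
    IsLowerSet S := by
  obtain ⟨t, -, rfl⟩ := hS
  exact isLowerSet_iInter₂ fun ab _ x y hyx =>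
    Or.imp hyx.1.trans hyx.2.trans

theorem atomTrace_subset_atomTrace_iff (h1 : AtomisticLat L1) (h2 : AtomisticLat L2)
    {S T : Set (L1 × L2)} (hS : IsLowerSet S) (hT : T ∈ boxProd L1 L2) :
    atomTrace S ⊆ atomTrace T ↔ S ⊆ T := by
  refine ⟨fun h x hx => ?_, fun h => preimage_mono h⟩
  obtain ⟨t, -, rfl⟩ := hT
  refine mem_iInter₂.2 fun ab hab => ?_
  by_contra hn
  obtain ⟨hn1, hn2⟩ := not_or.1 hn
  obtain ⟨p, hp, hpx, hpa⟩ := h1.exists_atom_le_not_le hn1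
  obtain ⟨q, hq, hqx, hqb⟩ := h2.exists_atom_le_not_le hn2
  have hpq : (⟨p, hp⟩, ⟨q, hq⟩) ∈ atomTrace S := hS (show (p, q) ≤ x from ⟨hpx, hqx⟩) hx
  exact (mem_iInter₂.1 (h hpq) ab hab).elim hpa hqb

end

/-- for atomistic lattices with 0 and 1, `L₁ ∧○_n L₂ ≅ L₁ □ L₂`. -/
theorem stmt2 (L1 L2 : Type*) [Lattice L1] [BoundedOrder L1]
    [Lattice L2] [BoundedOrder L2]
    (h1 : AtomisticLat L1) (h2 : AtomisticLat L2) :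
    Nonempty (↥(boxProd L1 L2) ≃o ↥(wedgeOn L1 L2)) := by
  let f : boxProd L1 L2 ↪o wedgeOn L1 L2 := OrderEmbedding.ofMapLEIff
    (fun S => ⟨atomTrace S, by
      obtain ⟨_, t, ht, rfl⟩ := S
      exact ⟨t, ht, atomTrace_iInter_box t⟩⟩)
    fun S T => atomTrace_subset_atomTrace_iff h1 h2 (isLowerSet_of_mem_boxProd S.2) T.2
  refine ⟨RelIso.ofSurjective f ?_⟩
  rintro ⟨_, t, ht, rfl⟩
  exact ⟨⟨_, t, ht, rfl⟩, Subtype.ext (atomTrace_iInter_box t)⟩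

end QLTensor
end

section
/- Let L_1 and L_2 be simple closure spaces on Σ_1 and Σ_2 respectively. Then the dual lattice (L_1 ∨○ L_2)* is order-isomorphic to the set of all maps f : L_1 → L_2* preserving arbitrary joins (i.e. maps f : L_1 → L_2 with f(⋁_{L_1} ω) = ⋀_{L_2} {f(x) : x ∈ ω} for every ω ⊆ L_1), ordered pointwise: f ≤ g iff f(p_1) ≤_* g(p_1) (i.e. g(p_1) ⊆ f(p_1) in L_2) for every atom p_1 ∈ Σ_1. -/
open Set

namespace QLTensor

universe u v w

/-- The closure of a set belongs to the simple closure space. -/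
theorem cl_mem {X : Type*} {L : Set (Set X)} (hL : IsSCS L) (A : Set X) : cl L A ∈ L :=
  hL.1 _ fun _ hb => hb.1

theorem subset_cl {X : Type*} (L : Set (Set X)) (A : Set X) : A ⊆ cl L A :=
  subset_sInter fun _ hb => hb.2

theorem cl_subset {X : Type*} {L : Set (Set X)} {A b : Set X} (hb : b ∈ L) (h : A ⊆ b) :
    cl L A ⊆ b :=
  sInter_subset_of_mem ⟨hb, h⟩

theorem cl_eq_self {X : Type*} {L : Set (Set X)} {a : Set X} (ha : a ∈ L) : cl L a = a :=
  (cl_subset ha Subset.rfl).antisymm (subset_cl L a)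

section JoinToMeet

variable {X Y : Type*} {L1 : Set (Set X)} {L2 : Set (Set Y)}

/-- `f` sends arbitrary joins of `L1` to the corresponding meets of `L2`. -/
def JoinToMeet (f : ↥L1 → ↥L2) : Prop :=
  ∀ (ω : Set ↥L1) (J : ↥L1),
    (J : Set X) = cl L1 (⋃ x ∈ ω, (x : Set X)) →
    (f J : Set Y) = ⋂₀ ((fun x => ((f x : Set Y))) '' ω)

theorem JoinToMeet.mem_iff {f : ↥L1 → ↥L2} (hf : JoinToMeet f) {ω : Set ↥L1} {J : ↥L1}
    (hJ : (J : Set X) = cl L1 (⋃ x ∈ ω, (x : Set X))) {y : Y} :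
    y ∈ (f J : Set Y) ↔ ∀ x ∈ ω, y ∈ (f x : Set Y) := by
  rw [hf ω J hJ]
  simp only [sInter_image, mem_iInter]

theorem JoinToMeet.antitone {f : ↥L1 → ↥L2} (hf : JoinToMeet f) {a b : ↥L1}
    (hab : (a : Set X) ⊆ b) : (f b : Set Y) ⊆ f a := by
  have hb : (b : Set X) = cl L1 (⋃ x ∈ ({a, b} : Set ↥L1), (x : Set X)) := by
    rw [biUnion_pair, union_eq_self_of_subset_left hab, cl_eq_self b.2]
  exact fun y hy => (hf.mem_iff hb).1 hy a (mem_insert _ _)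

/-- The value at the closure of `A` is determined by the values at the points of `A`. -/
theorem JoinToMeet.mem_iff_of_eq_cl {f : ↥L1 → ↥L2} (hf : JoinToMeet f) (hL1 : IsSCS L1)
    {A : Set X} {J : ↥L1} (hJ : (J : Set X) = cl L1 A) {y : Y} :
    y ∈ (f J : Set Y) ↔ ∀ x ∈ A, y ∈ (f ⟨{x}, hL1.2.2.2 x⟩ : Set Y) := by
  have h : (J : Set X) =
      cl L1 (⋃ s ∈ (fun x => (⟨{x}, hL1.2.2.2 x⟩ : ↥L1)) '' A, (s : Set X)) := by
    rw [hJ, biUnion_image]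
    exact congrArg (cl L1) (biUnion_of_singleton A).symm
  rw [hf.mem_iff h, forall_mem_image]

/-- The map `a ↦ ⋂_{x ∈ a} R₂[(x, ·)]` attached to `R ∈ L₁ ∨○ L₂`. -/
def polarMap (hL2 : IsSCS L2) (R : ↥(veeO2 L1 L2)) (a : ↥L1) : ↥L2 :=
  ⟨⋂₀ ((fun x => {y | (x, y) ∈ (R : Set (X × Y))}) '' (a : Set X)),
    hL2.1 _ (image_subset_iff.2 fun x _ => R.2.2 x)⟩

theorem mem_polarMap (hL2 : IsSCS L2) (R : ↥(veeO2 L1 L2)) (a : ↥L1) (y : Y) :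
    y ∈ (polarMap hL2 R a : Set Y) ↔ ∀ x ∈ (a : Set X), (x, y) ∈ (R : Set (X × Y)) := by
  simp only [polarMap, sInter_image, mem_iInter, mem_ofPred_eq]

theorem mem_polarMap_singleton (hL1 : IsSCS L1) (hL2 : IsSCS L2) (R : ↥(veeO2 L1 L2))
    (x : X) (y : Y) :
    y ∈ (polarMap hL2 R ⟨{x}, hL1.2.2.2 x⟩ : Set Y) ↔ (x, y) ∈ (R : Set (X × Y)) := by
  simp only [mem_polarMap, mem_singleton_iff, forall_eq]

theorem joinToMeet_polarMap (hL2 : IsSCS L2) (R : ↥(veeO2 L1 L2)) :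
    JoinToMeet (polarMap hL2 R) := by
  intro ω J hJ
  ext y
  simp only [sInter_image, mem_iInter, mem_polarMap]
  refine ⟨fun h a ha x hx => h x ?_, fun h x hx => ?_⟩
  · rw [hJ]
    exact subset_cl _ _ (mem_biUnion ha hx)
  · rw [hJ] at hx
    exact cl_subset (R.2.1 y) (iUnion₂_subset fun a ha x hx => h a ha x hx) hx

/-- The relation `{(x, y) | y ∈ f {x}}`. -/
def graphRel (hL1 : IsSCS L1) (f : ↥L1 → ↥L2) : Set (X × Y) :=
  {p | p.2 ∈ (f ⟨{p.1}, hL1.2.2.2 p.1⟩ : Set Y)}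

theorem JoinToMeet.graphRel_mem {f : ↥L1 → ↥L2} (hf : JoinToMeet f) (hL1 : IsSCS L1) :
    graphRel hL1 f ∈ veeO2 L1 L2 := by
  refine ⟨fun y => ?_, fun x => (f ⟨{x}, hL1.2.2.2 x⟩).2⟩
  set A : Set X := {x | (x, y) ∈ graphRel hL1 f}
  have hy : y ∈ (f ⟨cl L1 A, cl_mem hL1 A⟩ : Set Y) :=
    (hf.mem_iff_of_eq_cl hL1 rfl).2 fun x hx => hx
  have hcl : cl L1 A = A :=
    Subset.antisymm (fun x hx => hf.antitone (singleton_subset_iff.2 hx) hy) (subset_cl L1 A)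
  exact hcl ▸ cl_mem hL1 A

/-- Elements of `L₁ ∨○ L₂` correspond to the maps `L₁ → L₂` sending joins to meets. -/
def veeO2Equiv (hL1 : IsSCS L1) (hL2 : IsSCS L2) :
    ↥(veeO2 L1 L2) ≃ {f : ↥L1 → ↥L2 // JoinToMeet f} where
  toFun R := ⟨polarMap hL2 R, joinToMeet_polarMap hL2 R⟩
  invFun f := ⟨graphRel hL1 f.1, f.2.graphRel_mem hL1⟩
  left_inv R := Subtype.ext (Set.ext fun p => mem_polarMap_singleton hL1 hL2 R p.1 p.2)
  right_inv f := Subtype.ext (funext fun a => Subtype.ext (Set.ext fun y =>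
    (mem_polarMap hL2 _ a y).trans (f.2.mem_iff_of_eq_cl hL1 (cl_eq_self a.2).symm).symm))

end JoinToMeet

/-- `(L₁ ∨○ L₂)*` is order-isomorphic to the set of maps `f : L₁ → L₂*`
preserving arbitrary joins (i.e. `f(⋁ ω) = ⋀ {f x : x ∈ ω}` in `L₂`), ordered pointwise
on atoms: `f ≤ g` iff `g(p₁) ⊆ f(p₁)` for every atom `p₁`. -/
theorem stmt3 {X Y : Type*} [Nonempty X] [Nonempty Y]
    (L1 : Set (Set X)) (L2 : Set (Set Y)) (hL1 : IsSCS L1) (hL2 : IsSCS L2) :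
    ∃ e : ↥(veeO2 L1 L2) ≃
      {f : ↥L1 → ↥L2 // ∀ (ω : Set ↥L1) (J : ↥L1),
        (J : Set X) = cl L1 (⋃ x ∈ ω, (x : Set X)) →
        (f J : Set Y) = ⋂₀ ((fun x => ((f x : Set Y))) '' ω)},
      ∀ R S : ↥(veeO2 L1 L2),
        (S : Set (X × Y)) ⊆ (R : Set (X × Y)) ↔
        ∀ p : X,
          ((e S).1 ⟨({p} : Set X), hL1.2.2.2 p⟩ : Set Y) ⊆
          ((e R).1 ⟨({p} : Set X), hL1.2.2.2 p⟩ : Set Y) := by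
  refine ⟨veeO2Equiv hL1 hL2, fun R S => ⟨fun h p y hy => ?_, fun h p hp => ?_⟩⟩
  · exact (mem_polarMap_singleton hL1 hL2 R p y).2
      (h ((mem_polarMap_singleton hL1 hL2 S p y).1 hy))
  · exact (mem_polarMap_singleton hL1 hL2 R p.1 p.2).1
      (h p.1 ((mem_polarMap_singleton hL1 hL2 S p.1 p.2).2 hp))

end QLTensor
end

section
/- Let {L_α}_{α∈Ω} be simple closure spaces, L_α on Σ_α, and let L be a simple closure space on 𝚺 = ∏_α Σ_α satisfying axiom (P2). Then: (1) if p, q ∈ 𝚺 satisfy p_β ≠ q_β for at least two indices β ∈ Ω, then p ∨_L q = {p, q}; (2) for all β ≠ γ ∈ Ω, all b ∈ L_β with p_β ∈ b and all c ∈ L_γ with p_γ ∈ c, p[b,β] ∨_L p[c,γ] = p[b,β] ∪ p[c,γ]. -/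
open Set

namespace QLTensor

universe u v w

/-- Under axiom P2, a set lying in `π_i⁻¹(S) ∪ π_j⁻¹(T)` has its closure there too. -/
theorem mem_or_mem_of_mem_cl {Ω : Type*} {σ : Ω → Type*}
    {L : ∀ α, Set (Set (σ α))} (hL : ∀ α, IsSCS (L α))
    {M : Set (Set (∀ α, σ α))} (hP2 : AxiomP2 L M) {i j : Ω} (hij : i ≠ j)
    {S : Set (σ i)} (hS : S ∈ L i) {T : Set (σ j)} (hT : T ∈ L j)
    {A : Set (∀ α, σ α)} (hA : ∀ q ∈ A, q i ∈ S ∨ q j ∈ T)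
    {r : ∀ α, σ α} (hr : r ∈ cl M A) : r i ∈ S ∨ r j ∈ T := by
  classical
  let a : ∀ α, Set (σ α) := Function.update (Function.update (fun _ => ∅) i S) j T
  have hai : a i = S := by simp [a, hij]
  have haj : a j = T := by simp [a]
  have ha : ∀ α, α ≠ i → α ≠ j → a α = ∅ := fun α h₁ h₂ => by simp [a, h₁, h₂]
  have haL : ∀ α, a α ∈ L α := by
    intro α
    by_cases h₂ : α = j
    · subst h₂; rwa [haj]
    by_cases h₁ : α = i
    · subst h₁; rwa [hai]
    rw [ha α h₁ h₂]
    exact (hL α).2.1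
  have hsub : A ⊆ unionCyl a := by
    intro q hq
    rcases hA q hq with h | h
    · exact ⟨i, by rwa [hai]⟩
    · exact ⟨j, by rwa [haj]⟩
  obtain ⟨α, hα⟩ := hr (unionCyl a) ⟨hP2 a haL, hsub⟩
  by_cases h₂ : α = j
  · subst h₂; exact Or.inr (by rwa [haj] at hα)
  by_cases h₁ : α = i
  · subst h₁; exact Or.inl (by rwa [hai] at hα)
  rw [ha α h₁ h₂] at hα
  exact hα.elim

/-- in a simple closure space on `∏_α Σ_α` satisfying axiom P2:
(1) if `p, q` differ in at least two coordinates then `p ∨ q = {p, q}`;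
(2) for `β ≠ γ`, `b ∈ L_β` with `p_β ∈ b` and `c ∈ L_γ` with `p_γ ∈ c`,
`p[b,β] ∨ p[c,γ] = p[b,β] ∪ p[c,γ]`. -/
theorem stmt13 {Ω : Type*} {σ : Ω → Type*} [∀ α, Nonempty (σ α)]
    (L : ∀ α, Set (Set (σ α))) (hL : ∀ α, IsSCS (L α))
    (M : Set (Set (∀ α, σ α))) (hM : IsSCS M) (hP2 : AxiomP2 L M) :
    (∀ p q : ∀ α, σ α, (∃ β γ, β ≠ γ ∧ p β ≠ q β ∧ p γ ≠ q γ) →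
      cl M {p, q} = {p, q}) ∧
    ∀ (p : ∀ α, σ α) (β γ : Ω), β ≠ γ →
      ∀ b ∈ L β, p β ∈ b → ∀ c ∈ L γ, p γ ∈ c →
        cl M (cylSet p β b ∪ cylSet p γ c) = cylSet p β b ∪ cylSet p γ c := by
  constructor
  · rintro p q ⟨β, γ, hβγ, hβ, hγ⟩
    refine Subset.antisymm (fun r hr => ?_) (subset_cl _ _)
    have key : ∀ i j, i ≠ j → r i = p i ∨ r j = q j := fun i j hij =>
      mem_or_mem_of_mem_cl hL hP2 hij ((hL i).2.2.2 (p i)) ((hL j).2.2.2 (q j))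
        (by rintro x (rfl | rfl) <;> simp) hr
    by_contra hne
    obtain ⟨hp, hq⟩ : r ≠ p ∧ r ≠ q := by simpa using hne
    obtain ⟨i, hi⟩ := Function.ne_iff.1 hp
    have hqi : ∀ j, j ≠ i → r j = q j := fun j hj => (key i j hj.symm).resolve_left hi
    obtain ⟨k, hk⟩ := Function.ne_iff.1 hq
    obtain rfl : k = i := by
      by_contra h
      exact hk (hqi k h)
    have hpq : ∀ j, j ≠ k → p j = q j := fun j hj =>
      ((key j k hj).resolve_right hk).symm.trans (hqi j hj)
    have hβk : β = k := by
      by_contra h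
      exact hβ (hpq β h)
    exact hγ (hpq γ (hβk ▸ hβγ.symm))
  · intro p β γ hβγ b hb hpb c hc hpc
    refine Subset.antisymm (fun r hr => ?_) (subset_cl _ _)
    have hout : ∀ δ, δ ≠ β → δ ≠ γ → r δ = p δ := by
      intro δ hδβ hδγ
      refine (mem_or_mem_of_mem_cl hL hP2 hδβ ((hL δ).2.2.2 (p δ)) (hL β).2.1 ?_
        hr).resolve_right id
      rintro q (hq | hq)
      · exact Or.inl (hq.2 δ hδβ)
      · exact Or.inl (hq.2 δ hδγ)
    have hrb : r β ∈ b := by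
      refine (mem_or_mem_of_mem_cl hL hP2 hβγ hb (hL γ).2.1 ?_ hr).resolve_right id
      rintro q (hq | hq)
      · exact Or.inl hq.1
      · exact Or.inl (by rwa [hq.2 β hβγ])
    have hrc : r γ ∈ c := by
      refine (mem_or_mem_of_mem_cl hL hP2 hβγ (hL β).2.1 hc ?_ hr).resolve_left id
      rintro q (hq | hq)
      · exact Or.inr (by rwa [hq.2 γ hβγ.symm])
      · exact Or.inr hq.1
    have hor : r β = p β ∨ r γ = p γ := by
      refine mem_or_mem_of_mem_cl hL hP2 hβγ ((hL β).2.2.2 (p β)) ((hL γ).2.2.2 (p γ)) ?_ hr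
      rintro q (hq | hq)
      · exact Or.inr (hq.2 γ hβγ.symm)
      · exact Or.inl (hq.2 β hβγ)
    rcases hor with h | h
    · refine Or.inr ⟨hrc, fun α hα => ?_⟩
      by_cases hαβ : α = β
      · rw [hαβ, h]
      · exact hout α hαβ hα
    · refine Or.inl ⟨hrb, fun α hα => ?_⟩
      by_cases hαγ : α = γ
      · rw [hαγ, h]
      · exact hout α hα hαγ

end QLTensor
end
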